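/- Let α, β ∈ S be pure spinors with α + β ≠ 0. Then α + β is pure if and only if the associated γ-planes intersect in codimension at most 2, i.e. dim(K_α ∩ K_β) ≥ m − 2. -/

import Mathlib

noncomputable section

open scoped TensorProduct

/-- The `(2m+1)`-dimensional space `V := N × N* × ℂ`. -/
abbrev Vsp (N : Type) [AddCommGroup N] [Module ℂ N] : Type := N × (N →ₗ[ℂ] ℂ) × ℂ

/-- The bilinear map `B((v,φ,t),(v',φ',t')) = φ(v') − t·t'`, whose diagonal is `Q`. -/
def Bform (N : Type) [AddCommGroup N] [Module ℂ N] : Vsp N →ₗ[ℂ] Vsp N →ₗ[ℂ] ℂ :=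
  LinearMap.mk₂ ℂ (fun x y => x.2.1 y.1 - x.2.2 * y.2.2)
    (fun x x' y => by simp only [Prod.fst_add, Prod.snd_add, LinearMap.add_apply]; ring)
    (fun c x y => by
      simp only [Prod.smul_fst, Prod.smul_snd, LinearMap.smul_apply, smul_eq_mul]; ring)
    (fun x y y' => by simp only [Prod.fst_add, Prod.snd_add, map_add]; ring)
    (fun c x y => by simp only [Prod.smul_fst, Prod.smul_snd, map_smul, smul_eq_mul]; ring)

/-- The quadratic form `Q(v, φ, t) := φ(v) − t²`. -/
def Qform (N : Type) [AddCommGroup N] [Module ℂ N] : QuadraticForm ℂ (Vsp N) :=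
  LinearMap.BilinMap.toQuadraticMap (Bform N)

/-- The polar form `g(x,y) := (Q(x+y) − Q(x) − Q(y))/2`. -/
def gform (N : Type) [AddCommGroup N] [Module ℂ N] (x y : Vsp N) : ℂ :=
  (Qform N (x + y) - Qform N x - Qform N y) / 2

/-- `σ` : the involution acting on `⋀^k N` as `(−1)^(m−k)`. -/
def sigmaMap (m : ℕ) (N : Type) [AddCommGroup N] [Module ℂ N] :
    ExteriorAlgebra ℂ N →ₗ[ℂ] ExteriorAlgebra ℂ N :=
  ((-1 : ℂ) ^ m) • (CliffordAlgebra.involute (Q := (0 : QuadraticForm ℂ N))).toLinearMap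

/-- `ρ(v, φ, t)(ξ) := v ∧ ξ − ι_φ(ξ) + t·σ(ξ)`. -/
def rho (m : ℕ) (N : Type) [AddCommGroup N] [Module ℂ N] :
    Vsp N →ₗ[ℂ] ExteriorAlgebra ℂ N →ₗ[ℂ] ExteriorAlgebra ℂ N :=
  (LinearMap.mul ℂ (ExteriorAlgebra ℂ N) ∘ₗ ExteriorAlgebra.ι ℂ ∘ₗ
      LinearMap.fst ℂ N ((N →ₗ[ℂ] ℂ) × ℂ))
  - (CliffordAlgebra.contractLeft (Q := (0 : QuadraticForm ℂ N)) ∘ₗ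
      LinearMap.fst ℂ (N →ₗ[ℂ] ℂ) ℂ ∘ₗ LinearMap.snd ℂ N ((N →ₗ[ℂ] ℂ) × ℂ))
  + (LinearMap.toSpanSingleton ℂ (ExteriorAlgebra ℂ N →ₗ[ℂ] ExteriorAlgebra ℂ N)
        (sigmaMap m N) ∘ₗ
      LinearMap.snd ℂ (N →ₗ[ℂ] ℂ) ℂ ∘ₗ LinearMap.snd ℂ N ((N →ₗ[ℂ] ℂ) × ℂ))

/-- `K_ξ := {x ∈ V : ρ(x)(ξ) = 0}`. -/
def Kker (m : ℕ) (N : Type) [AddCommGroup N] [Module ℂ N] (ξ : ExteriorAlgebra ℂ N) :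
    Submodule ℂ (Vsp N) :=
  LinearMap.ker ((rho m N).flip ξ)

/-- A linear map `ρ : V → End S` satisfying the Clifford relation for a bilinear form `B` on `V`
which identifies `V` with its dual. -/
structure IsCliffordAction {k V S : Type*} [Field k] [AddCommGroup V] [Module k V]
    [AddCommGroup S] [Module k S] (B : V →ₗ[k] V →ₗ[k] k) (ρ : V →ₗ[k] S →ₗ[k] S) : Prop where
  anticomm : ∀ x y s, ρ x (ρ y s) + ρ y (ρ x s) = B x y • s
  symm : ∀ x y, B x y = B y x
  surjective : Function.Surjective B

namespace IsCliffordAction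

variable {k V S : Type*} [Field k] [AddCommGroup V] [Module k V]
  [AddCommGroup S] [Module k S] {B : V →ₗ[k] V →ₗ[k] k} {ρ : V →ₗ[k] S →ₗ[k] S}

/-- The common kernel in `S` of a family of vectors acting through `ρ`. -/
def commonKer (ρ : V →ₗ[k] S →ₗ[k] S) {ι : Type*} (v : ι → V) : Submodule k S :=
  ⨅ i, LinearMap.ker (ρ (v i))

theorem mem_commonKer {ι : Type*} {v : ι → V} {s : S} :
    s ∈ commonKer ρ v ↔ ∀ i, ρ (v i) s = 0 := by
  simp [commonKer]

theorem apply_comm_of_eq_zero (h : IsCliffordAction B ρ) {x y : V} (hxy : B x y = 0) (s : S) :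
    ρ x (ρ y s) = -ρ y (ρ x s) := by
  have := h.anticomm x y s
  rw [hxy, zero_smul] at this
  exact eq_neg_of_add_eq_zero_left this

theorem apply_apply_self [NeZero (2 : k)] (h : IsCliffordAction B ρ) {x : V} (hx : B x x = 0)
    (s : S) : ρ x (ρ x s) = 0 := by
  have := h.anticomm x x s
  rw [hx, zero_smul, ← two_smul k] at this
  exact (smul_eq_zero.mp this).resolve_left two_ne_zero

/-- The annihilator of a nonzero spinor is totally isotropic. -/
theorem isotropic_ker (h : IsCliffordAction B ρ) {s : S} (hs : s ≠ 0) {x y : V}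
    (hx : ρ x s = 0) (hy : ρ y s = 0) : B x y = 0 := by
  have := h.anticomm x y s
  rw [hx, hy, map_zero, map_zero, add_zero] at this
  exact (smul_eq_zero.mp this.symm).resolve_right hs

/-- Each independent isotropic vector halves the dimension of the common kernel. -/
theorem finrank_commonKer [NeZero (2 : k)] [FiniteDimensional k S] (h : IsCliffordAction B ρ)
    {n : ℕ} (v : Fin n → V) (hv : LinearIndependent k v) (hiso : ∀ i j, B (v i) (v j) = 0) :
    Module.finrank k (commonKer ρ v) * 2 ^ n = Module.finrank k S := by
  induction n with
  | zero =>
    have : commonKer ρ v = ⊤ := iInf_of_empty _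
    rw [this, finrank_top, pow_zero, mul_one]
  | succ n ih =>
    obtain ⟨htail, hnot⟩ := linearIndependent_finSucc.mp hv
    have key := ih (Fin.tail v) htail (fun i j => hiso i.succ j.succ)
    obtain ⟨f, hf0, hf⟩ := Submodule.exists_le_ker_of_notMem hnot
    obtain ⟨w, rfl⟩ := h.surjective f
    have hw : ∀ i, B w (Fin.tail v i) = 0 := fun i =>
      hf (Submodule.subset_span (Set.mem_range_self i))
    have hle : commonKer ρ v ≤ commonKer ρ (Fin.tail v) := fun s hs =>
      mem_commonKer.mpr fun i => mem_commonKer.mp hs i.succ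
    have hrange : LinearMap.range ((ρ (v 0)).domRestrict (commonKer ρ (Fin.tail v))) =
        commonKer ρ v := by
      ext s
      constructor
      · rintro ⟨⟨t, ht⟩, rfl⟩
        refine mem_commonKer.mpr (Fin.cases ?_ fun i => ?_)
        · exact h.apply_apply_self (hiso 0 0) t
        · have hti : ρ (v i.succ) t = 0 := mem_commonKer.mp ht i
          rw [LinearMap.domRestrict_apply, h.apply_comm_of_eq_zero (hiso _ _), hti, map_zero,
            neg_zero]
      · intro hs
        have hws : ρ w s ∈ commonKer ρ (Fin.tail v) := by
          refine mem_commonKer.mpr fun i => ?_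
          have hsi : ρ (Fin.tail v i) s = 0 := mem_commonKer.mp hs i.succ
          rw [h.apply_comm_of_eq_zero ((h.symm _ _).trans (hw i)), hsi, map_zero, neg_zero]
        refine ⟨(B w (v 0))⁻¹ • ⟨ρ w s, hws⟩, ?_⟩
        have hs0 : ρ (v 0) s = 0 := mem_commonKer.mp hs 0
        have := h.anticomm w (v 0) s
        rw [hs0, map_zero, zero_add] at this
        rw [map_smul, LinearMap.domRestrict_apply, this, smul_smul, inv_mul_cancel₀ hf0, one_smul]
    have hker : LinearMap.ker ((ρ (v 0)).domRestrict (commonKer ρ (Fin.tail v))) =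
        (commonKer ρ v).comap (commonKer ρ (Fin.tail v)).subtype := by
      ext ⟨t, ht⟩
      simp only [LinearMap.mem_ker, LinearMap.domRestrict_apply, Submodule.mem_comap,
        Submodule.subtype_apply, mem_commonKer]
      exact ⟨fun h0 => Fin.cases h0 (mem_commonKer.mp ht), fun h0 => h0 0⟩
    have hsum := LinearMap.finrank_range_add_finrank_ker
      ((ρ (v 0)).domRestrict (commonKer ρ (Fin.tail v)))
    rw [hrange, hker, (Submodule.comapSubtypeEquivOfLe hle).finrank_eq] at hsum
    rw [← key, ← hsum]
    ring

variable [FiniteDimensional k V]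

/-- A functional outside a subspace of the dual is nonzero at some common zero of the subspace. -/
theorem exists_apply_ne_zero_of_notMem {p : Submodule k (Module.Dual k V)} {f : Module.Dual k V}
    (hf : f ∉ p) : ∃ a, f a ≠ 0 ∧ ∀ g ∈ p, g a = 0 := by
  rw [← Subspace.dualCoannihilator_dualAnnihilator_eq (W := p),
    Submodule.mem_dualAnnihilator] at hf
  push Not at hf
  obtain ⟨a, ha, hfa⟩ := hf
  exact ⟨a, hfa, (Submodule.mem_dualCoannihilator a).mp ha⟩

/-- A vector orthogonal to the annihilator of `s` maps `s` into the common kernel of that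
annihilator. -/
theorem finrank_le_finrank_ker_add [FiniteDimensional k S] (h : IsCliffordAction B ρ) (s : S) :
    Module.finrank k V ≤ 2 * Module.finrank k (LinearMap.ker (ρ.flip s)) +
      Module.finrank k (commonKer ρ ((↑) : LinearMap.ker (ρ.flip s) → V)) := by
  set K := LinearMap.ker (ρ.flip s) with hK
  set r : V →ₗ[k] Module.Dual k K := K.dualRestrict ∘ₗ B with hr
  have hcomm : LinearMap.range ((ρ.flip s).domRestrict (LinearMap.ker r)) ≤
      commonKer ρ ((↑) : K → V) := by
    rintro _ ⟨⟨x, hx⟩, rfl⟩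
    refine mem_commonKer.mpr fun y => ?_
    have hxy : B x y = 0 := LinearMap.congr_fun (LinearMap.mem_ker.mp hx) y
    have hys : ρ y s = 0 := y.2
    rw [LinearMap.domRestrict_apply, LinearMap.flip_apply,
      h.apply_comm_of_eq_zero ((h.symm _ _).trans hxy), hys, map_zero, neg_zero]
  have hker : Module.finrank k (LinearMap.ker ((ρ.flip s).domRestrict (LinearMap.ker r))) ≤
      Module.finrank k K := by
    rw [LinearMap.ker_domRestrict]
    rw [← Submodule.finrank_map_subtype_eq]
    exact Submodule.finrank_mono (Submodule.map_comap_le _ _)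
  have h₁ := LinearMap.finrank_range_add_finrank_ker r
  have h₂ := LinearMap.finrank_range_add_finrank_ker ((ρ.flip s).domRestrict (LinearMap.ker r))
  have h₃ := Submodule.finrank_mono hcomm
  have h₄ := Submodule.finrank_le (LinearMap.range r)
  rw [Subspace.dual_finrank_eq] at h₄
  omega

theorem finrank_commonKer_coe [NeZero (2 : k)] [FiniteDimensional k S] (h : IsCliffordAction B ρ)
    (W : Submodule k V) (hW : ∀ x ∈ W, ∀ y ∈ W, B x y = 0) :
    Module.finrank k (commonKer ρ ((↑) : W → V)) * 2 ^ Module.finrank k W =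
      Module.finrank k S := by
  have hb : commonKer ρ ((↑) : W → V) =
      commonKer ρ (fun i => (Module.finBasis k W i : V)) := by
    ext s
    simp only [mem_commonKer]
    refine ⟨fun hs i => hs _, fun hs x => ?_⟩
    have : ρ.flip s ∘ₗ W.subtype = 0 := (Module.finBasis k W).ext fun i => by simpa using hs i
    simpa using LinearMap.congr_fun this x
  rw [hb]
  exact h.finrank_commonKer _
    ((Module.finBasis k W).linearIndependent.map' W.subtype W.ker_subtype)
    fun i j => hW _ (Subtype.prop _) _ (Subtype.prop _)

variable [NeZero (2 : k)] [FiniteDimensional k S] {m : ℕ}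

theorem finrank_le_of_isotropic (h : IsCliffordAction B ρ) (hS : Module.finrank k S = 2 ^ m)
    (W : Submodule k V) (hW : ∀ x ∈ W, ∀ y ∈ W, B x y = 0) : Module.finrank k W ≤ m := by
  have := h.finrank_commonKer_coe W hW
  rw [hS] at this
  exact (Nat.pow_dvd_pow_iff_le_right (by norm_num)).mp (Dvd.intro_left _ this)

/-- A null vector orthogonal to a maximal isotropic subspace belongs to it. -/
theorem mem_of_isotropic (h : IsCliffordAction B ρ) (hS : Module.finrank k S = 2 ^ m)
    (W : Submodule k V) (hW : ∀ x ∈ W, ∀ y ∈ W, B x y = 0) (hdim : Module.finrank k W = m)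
    {x : V} (hx : B x x = 0) (hxW : ∀ y ∈ W, B x y = 0) : x ∈ W := by
  by_contra hnot
  have hlt : W < W ⊔ Submodule.span k {x} := by
    refine lt_of_le_of_ne le_sup_left fun heq => hnot ?_
    rw [heq]
    exact Submodule.mem_sup_right (Submodule.mem_span_singleton_self x)
  have hle : Module.finrank k (W ⊔ Submodule.span k {x} : Submodule k V) ≤ m := by
    refine h.finrank_le_of_isotropic hS _ fun a ha b hb => ?_
    obtain ⟨a', ha', a'', ha'', rfl⟩ := Submodule.mem_sup.mp ha
    obtain ⟨b', hb', b'', hb'', rfl⟩ := Submodule.mem_sup.mp hb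
    obtain ⟨r, rfl⟩ := Submodule.mem_span_singleton.mp ha''
    obtain ⟨s, rfl⟩ := Submodule.mem_span_singleton.mp hb''
    simp [hW a' ha' b' hb', hxW b' hb', (h.symm a' x).trans (hxW a' ha'), hx]
  have := Submodule.finrank_lt_finrank_of_lt hlt
  omega

/-- A nonzero spinor annihilated by an isotropic subspace of codimension at most two is pure. -/
theorem finrank_ker_eq_of_sub_two_le (h : IsCliffordAction B ρ)
    (hS : Module.finrank k S = 2 ^ m) (hV : Module.finrank k V = 2 * m + 1) {s : S} (hs : s ≠ 0)
    (hle : m - 2 ≤ Module.finrank k (LinearMap.ker (ρ.flip s))) :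
    Module.finrank k (LinearMap.ker (ρ.flip s)) = m := by
  have hiso : ∀ x ∈ LinearMap.ker (ρ.flip s), ∀ y ∈ LinearMap.ker (ρ.flip s), B x y = 0 :=
    fun x hx y hy => h.isotropic_ker hs hx hy
  have hmax := h.finrank_le_of_isotropic hS _ hiso
  have hhalf := h.finrank_commonKer_coe _ hiso
  have hrank := h.finrank_le_finrank_ker_add s
  rw [hS] at hhalf
  rw [hV] at hrank
  generalize Module.finrank k (LinearMap.ker (ρ.flip s)) = d at *
  obtain ⟨c, rfl⟩ := Nat.exists_eq_add_of_le hmax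
  rw [add_comm d c, pow_add] at hhalf
  rw [Nat.eq_of_mul_eq_mul_right (by positivity) hhalf] at hrank
  have hc : c ≤ 2 := by omega
  interval_cases c <;> omega

/-- If the sum of two pure spinors is pure, their annihilators meet in codimension at most two. -/
theorem sub_two_le_finrank_inf (h : IsCliffordAction B ρ) (hS : Module.finrank k S = 2 ^ m)
    {α β : S} (hα0 : α ≠ 0) (hα : Module.finrank k (LinearMap.ker (ρ.flip α)) = m)
    (hβ0 : β ≠ 0) (hβ : Module.finrank k (LinearMap.ker (ρ.flip β)) = m)
    (hαβ0 : α + β ≠ 0) (hαβ : Module.finrank k (LinearMap.ker (ρ.flip (α + β))) = m) :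
    m - 2 ≤ Module.finrank k
      (LinearMap.ker (ρ.flip α) ⊓ LinearMap.ker (ρ.flip β) : Submodule k V) := by
  by_contra! hlt
  set Kα := LinearMap.ker (ρ.flip α) with hKα
  set Kβ := LinearMap.ker (ρ.flip β) with hKβ
  set r : V →ₗ[k] Module.Dual k Kα := Kα.dualRestrict ∘ₗ B with hr
  have hmem : ∀ x, B x x = 0 → r x = 0 → x ∈ Kα := fun x hx hrx =>
    h.mem_of_isotropic hS Kα (fun a ha b hb => h.isotropic_ker hα0 ha hb) hα hx
      fun y hy => LinearMap.congr_fun hrx ⟨y, hy⟩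
  have hrank : 3 ≤ Module.finrank k (Kβ.map r) := by
    have hker : LinearMap.ker (r.domRestrict Kβ) ≤ (Kα ⊓ Kβ).comap Kβ.subtype := by
      rintro ⟨x, hx⟩ hrx
      exact ⟨hmem x (h.isotropic_ker hβ0 hx hx) hrx, hx⟩
    have h₁ := LinearMap.finrank_range_add_finrank_ker (r.domRestrict Kβ)
    have h₂ := Submodule.finrank_mono hker
    rw [(Submodule.comapSubtypeEquivOfLe inf_le_right).finrank_eq] at h₂
    rw [LinearMap.range_domRestrict] at h₁
    omega
  obtain ⟨c, hcγ, hcα⟩ : ∃ c ∈ LinearMap.ker (ρ.flip (α + β)), c ∉ Kα := by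
    by_contra! hsub
    have hsub' : LinearMap.ker (ρ.flip (α + β)) ≤ Kα ⊓ Kβ := by
      intro c hc
      have hcα : ρ c α = 0 := hsub c hc
      have hcγ : ρ c (α + β) = 0 := hc
      rw [map_add, hcα, zero_add] at hcγ
      exact ⟨hcα, hcγ⟩
    have := Submodule.finrank_mono hsub'
    omega
  have hrc : r c ∉ (⊥ : Submodule k (Module.Dual k Kα)) := fun h0 =>
    hcα (hmem c (h.isotropic_ker hαβ0 hcγ hcγ) h0)
  obtain ⟨_, ⟨y, hyβ, rfl⟩, hy⟩ : ∃ f ∈ Kβ.map r, f ∉ Submodule.span k {r c} := by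
    by_contra! hsub
    have h₁ := Submodule.finrank_mono (show Kβ.map r ≤ _ from hsub)
    have h₂ := finrank_span_le_card (R := k) ({r c} : Set (Module.Dual k Kα))
    simp only [Set.toFinset_singleton, Finset.card_singleton] at h₂
    omega
  obtain ⟨_, ⟨z, hzβ, rfl⟩, hz⟩ : ∃ f ∈ Kβ.map r, f ∉ Submodule.span k {r y, r c} := by
    classical
    by_contra! hsub
    have h₁ := Submodule.finrank_mono (show Kβ.map r ≤ _ from hsub)
    have h₂ := finrank_span_le_card (R := k) ({r y, r c} : Set (Module.Dual k Kα))
    have h₃ := Finset.card_le_two (a := r y) (b := r c)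
    simp only [Set.toFinset_insert, Set.toFinset_singleton] at h₂
    omega
  have hzero : ρ z (ρ y (ρ c α)) = 0 := by
    have hyβ' : ρ y β = 0 := hyβ
    have hzβ' : ρ z β = 0 := hzβ
    have hcα' : ρ c α = -ρ c β := by
      have : ρ c (α + β) = 0 := hcγ
      rw [map_add] at this
      exact eq_neg_of_add_eq_zero_left this
    have hycβ := h.anticomm y c β
    rw [hyβ', map_zero, add_zero] at hycβ
    rw [hcα', map_neg, map_neg, hycβ, map_smul, hzβ', smul_zero, neg_zero]
  have hcancel : ∀ (x : V) (s : S) (p : Submodule k (Module.Dual k Kα)), r x ∉ p →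
      (∀ a : Kα, (∀ g ∈ p, g a = 0) → ρ a s = 0) → ρ x s = 0 → s = 0 := by
    intro x s p hx hs hxs
    obtain ⟨a, hxa, hpa⟩ := exists_apply_ne_zero_of_notMem hx
    have := h.anticomm x a s
    rw [hs a hpa, hxs, map_zero, map_zero, add_zero] at this
    exact (smul_eq_zero.mp this.symm).resolve_left hxa
  have hann : ∀ (a : Kα) (x : V) (s : S), r x a = 0 → ρ a s = 0 → ρ a (ρ x s) = 0 := by
    intro a x s hxa has
    rw [h.apply_comm_of_eq_zero ((h.symm a x).trans hxa), has, map_zero, neg_zero]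
  refine hα0 (hcancel c α ⊥ hrc (fun a _ => a.2) ?_)
  refine hcancel y _ _ hy (fun a ha => ?_) ?_
  · exact hann a c α (ha _ (Submodule.mem_span_singleton_self _)) a.2
  refine hcancel z _ _ hz (fun a ha => ?_) hzero
  exact hann a y _ (ha _ (Submodule.subset_span (by simp)))
    (hann a c α (ha _ (Submodule.subset_span (by simp))) a.2)

end IsCliffordAction

theorem contractLeft_involute {R M : Type*} [CommRing R] [AddCommGroup M] [Module R M]
    {Q : QuadraticForm R M} (d : Module.Dual R M) (x : CliffordAlgebra Q) :
    CliffordAlgebra.contractLeft d (CliffordAlgebra.involute x) =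
      -CliffordAlgebra.involute (CliffordAlgebra.contractLeft d x) := by
  induction x using CliffordAlgebra.left_induction with
  | algebraMap r => simp
  | add x y hx hy => simp only [map_add, hx, hy, neg_add]
  | ι_mul x m hx =>
    simp only [map_mul, CliffordAlgebra.involute_ι, neg_mul, map_neg,
      CliffordAlgebra.contractLeft_ι_mul, hx, map_sub, map_smul]
    simp only [mul_neg, neg_sub]

theorem rho_apply (m : ℕ) (N : Type) [AddCommGroup N] [Module ℂ N] (x : Vsp N)
    (s : ExteriorAlgebra ℂ N) :
    rho m N x s = ExteriorAlgebra.ι ℂ x.1 * s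
      - CliffordAlgebra.contractLeft (Q := (0 : QuadraticForm ℂ N)) x.2.1 s
      + x.2.2 • sigmaMap m N s := rfl

theorem sigmaMap_sigmaMap (m : ℕ) (N : Type) [AddCommGroup N] [Module ℂ N]
    (s : ExteriorAlgebra ℂ N) : sigmaMap m N (sigmaMap m N s) = s := by
  simp only [sigmaMap, LinearMap.smul_apply, map_smul, AlgHom.toLinearMap_apply,
    CliffordAlgebra.involute_involute, smul_smul, ← mul_pow]
  simp

theorem sigmaMap_ι_mul (m : ℕ) (N : Type) [AddCommGroup N] [Module ℂ N] (v : N)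
    (s : ExteriorAlgebra ℂ N) :
    sigmaMap m N (ExteriorAlgebra.ι ℂ v * s) = -(ExteriorAlgebra.ι ℂ v * sigmaMap m N s) := by
  have : CliffordAlgebra.involute (ExteriorAlgebra.ι ℂ v * s) =
      -(ExteriorAlgebra.ι ℂ v * CliffordAlgebra.involute (Q := (0 : QuadraticForm ℂ N)) s) := by
    rw [map_mul, ← neg_mul]
    exact congrArg (· * _) (CliffordAlgebra.involute_ι v)
  simp only [sigmaMap, LinearMap.smul_apply, AlgHom.toLinearMap_apply, this, smul_neg,
    mul_smul_comm]

theorem sigmaMap_contractLeft (m : ℕ) (N : Type) [AddCommGroup N] [Module ℂ N]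
    (φ : Module.Dual ℂ N) (s : ExteriorAlgebra ℂ N) :
    sigmaMap m N (CliffordAlgebra.contractLeft (Q := (0 : QuadraticForm ℂ N)) φ s) =
      -CliffordAlgebra.contractLeft (Q := (0 : QuadraticForm ℂ N)) φ (sigmaMap m N s) := by
  simp only [sigmaMap, LinearMap.smul_apply, AlgHom.toLinearMap_apply, map_smul,
    contractLeft_involute, smul_neg, neg_neg]

theorem isCliffordAction_rho (m : ℕ) (N : Type) [AddCommGroup N] [Module ℂ N]
    [FiniteDimensional ℂ N] :
    IsCliffordAction (-(Bform N + (Bform N).flip)) (rho m N) where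
  anticomm x y s := by
    obtain ⟨v, φ, t⟩ := x
    obtain ⟨v', φ', t'⟩ := y
    have hv : ExteriorAlgebra.ι ℂ v * (ExteriorAlgebra.ι ℂ v' * s) =
        -(ExteriorAlgebra.ι ℂ v' * (ExteriorAlgebra.ι ℂ v * s)) := by
      rw [← mul_assoc, ← mul_assoc, ← neg_mul,
        eq_neg_of_add_eq_zero_left (ExteriorAlgebra.ι_add_mul_swap v v')]
    have hc : ∀ (ψ : Module.Dual ℂ N) (w : N),
        CliffordAlgebra.contractLeft (Q := (0 : QuadraticForm ℂ N)) ψ (ExteriorAlgebra.ι ℂ w * s) =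
          ψ w • s - ExteriorAlgebra.ι ℂ w *
            CliffordAlgebra.contractLeft (Q := (0 : QuadraticForm ℂ N)) ψ s :=
      fun ψ w => CliffordAlgebra.contractLeft_ι_mul ψ w s
    have hB : (-(Bform N + (Bform N).flip)) (v, φ, t) (v', φ', t') =
        -(φ v' + φ' v - 2 * (t * t')) := by
      simp only [LinearMap.neg_apply, LinearMap.add_apply, LinearMap.flip_apply, Bform,
        LinearMap.mk₂_apply]
      ring
    rw [hB]
    simp only [rho_apply, map_add, map_sub, map_smul, sigmaMap_ι_mul,
      sigmaMap_contractLeft, sigmaMap_sigmaMap, hc, hv,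
      CliffordAlgebra.contractLeft_comm φ φ' s]
    module
  symm x y := by
    simp only [LinearMap.neg_apply, LinearMap.add_apply, LinearMap.flip_apply, add_comm]
  surjective := by
    have hinj : Function.Injective (-(Bform N + (Bform N).flip)) := by
      rw [← LinearMap.ker_eq_bot, LinearMap.ker_eq_bot']
      rintro ⟨v, φ, t⟩ hx
      have hB : ∀ (v' : N) (φ' : N →ₗ[ℂ] ℂ) (t' : ℂ), φ v' - t * t' + (φ' v - t' * t) = 0 :=
        fun v' φ' t' =>
          neg_eq_zero.mp (LinearMap.congr_fun hx (v', φ', t'))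
      have hφ : φ = 0 := LinearMap.ext fun v' => by simpa using hB v' 0 0
      have hv : v = 0 := (Module.forall_dual_apply_eq_zero_iff ℂ v).mp fun φ' => by
        simpa using hB 0 φ' 0
      have ht : t = 0 := by
        have := hB 0 0 1
        simp only [map_zero, LinearMap.zero_apply] at this
        linear_combination (-1 / 2) * this
      rw [hφ, hv, ht]
      rfl
    exact (LinearMap.injective_iff_surjective_of_finrank_eq_finrank
      (Subspace.dual_finrank_eq (K := ℂ) (V := Vsp N)).symm).mp hinj

theorem finite_and_finrank_exteriorAlgebra (K N : Type*) [Field K] [AddCommGroup N] [Module K N]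
    [FiniteDimensional K N] : FiniteDimensional K (ExteriorAlgebra K N) ∧
      Module.finrank K (ExteriorAlgebra K N) = 2 ^ Module.finrank K N := by
  have b := (Module.finBasis K N).ExteriorAlgebra
  exact ⟨b.finiteDimensional_of_finite, by rw [Module.finrank_eq_card_basis b]; simp⟩

/-- for pure spinors `α`, `β` with `α + β ≠ 0`, the sum `α + β` is pure
iff the γ-planes `K_α`, `K_β` intersect in codimension at most `2`. -/
theorem sum_of_pure_spinors_pure_iff
    (m : ℕ) (hm : 0 < m) (N : Type) [AddCommGroup N] [Module ℂ N]
    [FiniteDimensional ℂ N] (hdim : Module.finrank ℂ N = m)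
    (α β : ExteriorAlgebra ℂ N)
    (hα0 : α ≠ 0) (hα : Module.finrank ℂ (Kker m N α) = m)
    (hβ0 : β ≠ 0) (hβ : Module.finrank ℂ (Kker m N β) = m)
    (hαβ : α + β ≠ 0) :
    (α + β ≠ 0 ∧ Module.finrank ℂ (Kker m N (α + β)) = m) ↔
      m - 2 ≤ Module.finrank ℂ (Kker m N α ⊓ Kker m N β : Submodule ℂ (Vsp N)) := by
  obtain ⟨_, hS⟩ := finite_and_finrank_exteriorAlgebra ℂ N
  rw [hdim] at hS
  have h := isCliffordAction_rho m N
  have hV : Module.finrank ℂ (Vsp N) = 2 * m + 1 := by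
    rw [Module.finrank_prod, Module.finrank_prod, Module.finrank_self, hdim,
      (Subspace.dual_finrank_eq (K := ℂ) (V := N)).trans hdim]
    ring
  refine ⟨fun hγ => h.sub_two_le_finrank_inf hS hα0 hα hβ0 hβ hαβ hγ.2,
    fun hle => ⟨hαβ, h.finrank_ker_eq_of_sub_two_le hS hV hαβ (hle.trans ?_)⟩⟩
  refine Submodule.finrank_mono fun x hx => ?_
  have hxα : rho m N x α = 0 := hx.1
  have hxβ : rho m N x β = 0 := hx.2
  rw [LinearMap.mem_ker, LinearMap.flip_apply, map_add, hxα, hxβ, add_zero]
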